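/- arXiv:2107.06033 — 2 statements merged into one kernel-verified Lean document; each statement's English description precedes it below -/
import Mathlib

section
/- Assume additionally that there exist constants c₁, c₂ > 0, α ∈ [0,1), β ∈ [0,∞), C₁ > 0 and a natural number N₀ such that μ(B_r) ≤ c₁ r^β + c₂ for all r > 0, and |A|_∞(x) + |C|_∞(x)² · Φ_A(x)⁻¹ + ‖B̄(x)‖² ≤ C₁ ‖x‖^{2α} for Lebesgue-a.e. x with ‖x‖ > N₀. Then every bounded C¹ function h : ℝ^d → ℝ satisfying the weak resolvent identity vanishes identically on ℝ^d. -/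
open MeasureTheory Real
open scoped RealInnerProductSpace ENNReal

noncomputable section

/-- `⟨M v, w⟩` for a `d × d` matrix `M` and vectors `v, w ∈ ℝ^d`. -/
def mdot {d : ℕ} (M : Matrix (Fin d) (Fin d) ℝ) (v w : EuclideanSpace ℝ (Fin d)) : ℝ :=
  ∑ i, ∑ j, M i j * v j * w i

/-- `|M|_∞ = max_{i,j} |m_ij|`. -/
def matSup {d : ℕ} (M : Matrix (Fin d) (Fin d) ℝ) : ℝ :=
  ⨆ i, ⨆ j, |M i j|

/-- `Φ_M = inf_{ξ ≠ 0} ⟨M ξ, ξ⟩ / ‖ξ‖²`. -/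
def PhiA {d : ℕ} (M : Matrix (Fin d) (Fin d) ℝ) : ℝ :=
  ⨅ ξ : {ξ : EuclideanSpace ℝ (Fin d) // ξ ≠ 0}, mdot M ξ.1 ξ.1 / ‖ξ.1‖ ^ 2

/-- `h` satisfies the weak resolvent identity:
`(1/2)∫ ⟨(A+C)∇u, ∇h⟩ dμ + ∫ ⟨B̄, ∇u⟩ h dμ + ∫ u h dμ = 0` for every compactly supported
Lipschitz `u`. -/
def WeakResolvent {d : ℕ} (μ : Measure (EuclideanSpace ℝ (Fin d)))
    (A C : EuclideanSpace ℝ (Fin d) → Matrix (Fin d) (Fin d) ℝ)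
    (Bb : EuclideanSpace ℝ (Fin d) → EuclideanSpace ℝ (Fin d))
    (h : EuclideanSpace ℝ (Fin d) → ℝ) : Prop :=
  ∀ u : EuclideanSpace ℝ (Fin d) → ℝ,
    (∃ K, LipschitzWith K u) → HasCompactSupport u →
    (1/2) * (∫ x, mdot (A x + C x) (gradient u x) (gradient h x) ∂μ)
      + (∫ x, ⟪Bb x, gradient u x⟫ * h x ∂μ)
      + (∫ x, u x * h x ∂μ) = 0


theorem gradient_mul_apply {E : Type*} [NormedAddCommGroup E] [InnerProductSpace ℝ E]
    [CompleteSpace E] {f g : E → ℝ} {x : E} (hf : DifferentiableAt ℝ f x)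
    (hg : DifferentiableAt ℝ g x) :
    gradient (fun y => f y * g y) x = f x • gradient g x + g x • gradient f x := by
  simp only [gradient]
  rw [fderiv_fun_mul hf hg]
  simp

theorem norm_gradient_eq {E : Type*} [NormedAddCommGroup E] [InnerProductSpace ℝ E]
    [CompleteSpace E] (f : E → ℝ) (x : E) : ‖gradient f x‖ = ‖fderiv ℝ f x‖ := by
  simp [gradient]

theorem ContDiff.continuous_gradient_of_one {E : Type*} [NormedAddCommGroup E]
    [InnerProductSpace ℝ E] [CompleteSpace E] {f : E → ℝ} (hf : ContDiff ℝ 1 f) :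
    Continuous (gradient f) :=
  (InnerProductSpace.toDual ℝ E).symm.continuous.comp (hf.continuous_fderiv one_ne_zero)

theorem gradient_eq_zero_of_eventuallyEq_const {E : Type*} [NormedAddCommGroup E]
    [InnerProductSpace ℝ E] [CompleteSpace E] {f : E → ℝ} {x : E} {c : ℝ}
    (hf : f =ᶠ[nhds x] fun _ => c) : gradient f x = 0 := by
  simp [gradient, hf.fderiv_eq]

/-- Cutoff functions between concentric balls of radii `r` and `2 * r`, with gradient of order
`1 / r`. -/
theorem exists_scaled_cutoff (E : Type*) [NormedAddCommGroup E] [InnerProductSpace ℝ E]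
    [FiniteDimensional ℝ E] :
    ∃ L : ℝ, 0 ≤ L ∧ ∀ r : ℝ, 0 < r → ∃ φ : E → ℝ, ContDiff ℝ 1 φ ∧ HasCompactSupport φ ∧
      (∀ x, ‖x‖ ≤ r → φ x = 1) ∧ (∀ x, ‖gradient φ x‖ ≤ L / r) ∧
      ∀ x, gradient φ x ≠ 0 → r ≤ ‖x‖ ∧ ‖x‖ ≤ 2 * r := by
  let η : ContDiffBump (0 : E) := ⟨1, 2, one_pos, one_lt_two⟩
  have hη : ContDiff ℝ 1 η := η.contDiff
  obtain ⟨L, hL⟩ := hη.lipschitzWith_of_hasCompactSupport η.hasCompactSupport one_ne_zero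
  refine ⟨L, L.2, fun r hr => ?_⟩
  have hnorm (x : E) : ‖r⁻¹ • x‖ = ‖x‖ / r := by
    rw [norm_smul, norm_inv, Real.norm_of_nonneg hr.le]; field_simp
  have hone (x : E) (hx : ‖x‖ ≤ r) : η (r⁻¹ • x) = 1 := by
    apply η.one_of_mem_closedBall
    rw [mem_closedBall_zero_iff, hnorm]
    exact (div_le_one hr).2 hx
  have hzero (x : E) (hx : 2 * r < ‖x‖) : η (r⁻¹ • x) = 0 := by
    apply η.zero_of_le_dist
    rw [dist_zero_right, hnorm]
    exact (le_div_iff₀ hr).2 hx.le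
  refine ⟨fun x => η (r⁻¹ • x), hη.comp (contDiff_const_smul _), ?_, hone,
    fun x => ?_, fun x hx => ⟨?_, ?_⟩⟩
  · refine HasCompactSupport.intro (isCompact_closedBall (0 : E) (2 * r)) fun x hx => hzero x ?_
    simpa using hx
  · rw [norm_gradient_eq]
    have hlip : LipschitzWith (L * ‖r⁻¹‖₊) fun x : E => η (r⁻¹ • x) :=
      hL.comp (lipschitzWith_smul r⁻¹)
    refine (norm_fderiv_le_of_lipschitz ℝ hlip).trans_eq ?_
    simp [abs_of_pos hr, div_eq_mul_inv]
  · by_contra! hlt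
    refine hx (gradient_eq_zero_of_eventuallyEq_const (c := 1) ?_)
    filter_upwards [(isOpen_lt continuous_norm continuous_const).mem_nhds hlt] with y hy
    exact hone y (le_of_lt hy)
  · by_contra! hlt
    refine hx (gradient_eq_zero_of_eventuallyEq_const (c := 0) ?_)
    filter_upwards [(isOpen_lt continuous_const continuous_norm).mem_nhds hlt] with y hy
    exact hzero y hy

section mdot

variable {d : ℕ}

theorem mdot_add_matrix (M N : Matrix (Fin d) (Fin d) ℝ) (v w : EuclideanSpace ℝ (Fin d)) :
    mdot (M + N) v w = mdot M v w + mdot N v w := by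
  simp only [mdot, Matrix.add_apply, add_mul, Finset.sum_add_distrib]

theorem mdot_add_left (M : Matrix (Fin d) (Fin d) ℝ) (v w z : EuclideanSpace ℝ (Fin d)) :
    mdot M (v + w) z = mdot M v z + mdot M w z := by
  simp only [mdot, PiLp.add_apply, add_mul, mul_add, Finset.sum_add_distrib]

theorem mdot_smul_left (M : Matrix (Fin d) (Fin d) ℝ) (c : ℝ) (v w : EuclideanSpace ℝ (Fin d)) :
    mdot M (c • v) w = c * mdot M v w := by
  simp only [mdot, PiLp.smul_apply, smul_eq_mul, Finset.mul_sum]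
  exact Finset.sum_congr rfl fun i _ => Finset.sum_congr rfl fun j _ => by ring

theorem mdot_transpose (M : Matrix (Fin d) (Fin d) ℝ) (v w : EuclideanSpace ℝ (Fin d)) :
    mdot M.transpose v w = mdot M w v := by
  simp only [mdot, Matrix.transpose_apply]
  rw [Finset.sum_comm]
  exact Finset.sum_congr rfl fun i _ => Finset.sum_congr rfl fun j _ => by ring

theorem mdot_self_eq_zero {M : Matrix (Fin d) (Fin d) ℝ} (hM : M.transpose = -M)
    (v : EuclideanSpace ℝ (Fin d)) :
    mdot M v v = 0 := by
  have h1 := mdot_transpose M v v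
  have h2 : mdot (-M) v v = -mdot M v v := by simp [mdot]
  rw [hM, h2] at h1
  linarith

theorem abs_le_matSup (M : Matrix (Fin d) (Fin d) ℝ) (i j : Fin d) : |M i j| ≤ matSup M :=
  (le_ciSup (f := fun j => |M i j|) (Set.finite_range _).bddAbove j).trans
    (le_ciSup (f := fun i => ⨆ j, |M i j|) (Set.finite_range _).bddAbove i)

theorem matSup_nonneg (M : Matrix (Fin d) (Fin d) ℝ) : 0 ≤ matSup M :=
  Real.iSup_nonneg fun _ => Real.iSup_nonneg fun _ => abs_nonneg _

theorem abs_mdot_le (M : Matrix (Fin d) (Fin d) ℝ) (v w : EuclideanSpace ℝ (Fin d)) :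
    |mdot M v w| ≤ (d : ℝ) ^ 2 * (matSup M * ‖v‖ * ‖w‖) := by
  calc |mdot M v w| ≤ ∑ i, ∑ j, |M i j * v j * w i| :=
        (Finset.abs_sum_le_sum_abs _ _).trans
          (Finset.sum_le_sum fun i _ => Finset.abs_sum_le_sum_abs _ _)
    _ ≤ ∑ _i : Fin d, ∑ _j : Fin d, matSup M * ‖v‖ * ‖w‖ := by
        refine Finset.sum_le_sum fun i _ => Finset.sum_le_sum fun j _ => ?_
        rw [abs_mul, abs_mul]
        have hv : |v j| ≤ ‖v‖ := PiLp.norm_apply_le v j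
        have hw : |w i| ≤ ‖w‖ := PiLp.norm_apply_le w i
        have := matSup_nonneg M
        gcongr
        exact abs_le_matSup M i j
    _ = _ := by simp; ring

theorem mdot_eq_dotProduct (M : Matrix (Fin d) (Fin d) ℝ) (v w : EuclideanSpace ℝ (Fin d)) :
    mdot M v w = w.ofLp ⬝ᵥ M.mulVec v.ofLp := by
  simp only [mdot, dotProduct, Matrix.mulVec, Finset.mul_sum]
  exact Finset.sum_congr rfl fun i _ => Finset.sum_congr rfl fun j _ => by ring

theorem mdot_self_pos {M : Matrix (Fin d) (Fin d) ℝ} (hM : M.PosDef)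
    {v : EuclideanSpace ℝ (Fin d)} (hv : v ≠ 0) :
    0 < mdot M v v := by
  rw [mdot_eq_dotProduct]
  have := hM.dotProduct_mulVec_pos (x := v.ofLp) (by simpa using hv)
  simpa using this

theorem mdot_self_nonneg {M : Matrix (Fin d) (Fin d) ℝ} (hM : M.PosDef) (v : EuclideanSpace ℝ (Fin d)) :
    0 ≤ mdot M v v := by
  rcases eq_or_ne v 0 with rfl | hv
  · simp [mdot]
  · exact (mdot_self_pos hM hv).le

theorem continuous_mdot {X : Type*} [TopologicalSpace X] {M : X → Matrix (Fin d) (Fin d) ℝ}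
    {v w : X → EuclideanSpace ℝ (Fin d)} (hM : ∀ i j, Continuous fun x => M x i j) (hv : Continuous v)
    (hw : Continuous w) : Continuous fun x => mdot (M x) (v x) (w x) := by
  unfold mdot
  refine continuous_finsetSum _ fun i _ => continuous_finsetSum _ fun j _ => ?_
  exact ((hM i j).mul ((PiLp.continuous_apply 2 _ j).comp hv)).mul
    ((PiLp.continuous_apply 2 _ i).comp hw)

theorem PhiA_mul_sq_le {M : Matrix (Fin d) (Fin d) ℝ} (hM : M.PosDef) (v : EuclideanSpace ℝ (Fin d)) :
    PhiA M * ‖v‖ ^ 2 ≤ mdot M v v := by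
  rcases eq_or_ne v 0 with rfl | hv
  · simp [mdot]
  · rw [← le_div_iff₀ (by positivity)]
    refine ciInf_le (f := fun ξ : {ξ : EuclideanSpace ℝ (Fin d) // ξ ≠ 0} =>
      mdot M ξ.1 ξ.1 / ‖ξ.1‖ ^ 2) ?_ ⟨v, hv⟩
    refine ⟨0, ?_⟩
    rintro _ ⟨ξ, rfl⟩
    exact div_nonneg (mdot_self_nonneg hM _) (by positivity)

theorem PhiA_pos (hd : d ≠ 0) {M : Matrix (Fin d) (Fin d) ℝ} (hM : M.PosDef) : 0 < PhiA M := by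
  have : NeZero d := ⟨hd⟩
  obtain ⟨z, hz, hmin⟩ := (isCompact_sphere (0 : EuclideanSpace ℝ (Fin d)) 1).exists_isMinOn
    (NormedSpace.sphere_nonempty.2 zero_le_one)
    (continuous_mdot (fun i j => continuous_const (y := M i j)) continuous_id
      continuous_id).continuousOn
  have hz1 : ‖z‖ = 1 := by simpa using hz
  refine (mdot_self_pos hM (v := z) (by rintro rfl; simp at hz1)).trans_le ?_
  have : Nonempty {ξ : EuclideanSpace ℝ (Fin d) // ξ ≠ 0} := ⟨⟨z, by rintro rfl; simp at hz1⟩⟩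
  refine le_ciInf fun ξ => ?_
  have hξ : 0 < ‖ξ.1‖ := norm_pos_iff.2 ξ.2
  have h1 : mdot M z z ≤ mdot M (‖ξ.1‖⁻¹ • ξ.1) (‖ξ.1‖⁻¹ • ξ.1) :=
    hmin (by simp [norm_smul, hξ.ne'])
  refine h1.trans_eq ?_
  rw [mdot_smul_left, ← mdot_transpose, mdot_smul_left, mdot_transpose]
  field_simp

/-- Pointwise lower bound for the integrand of the energy identity. -/
theorem energy_integrand_ge (hd : d ≠ 0) {A C : Matrix (Fin d) (Fin d) ℝ} (hA : A.PosDef)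
    (hAs : A.IsSymm) (b p q : EuclideanSpace ℝ (Fin d)) (s t : ℝ) :
    (1 / 2) * (s * t) ^ 2 -
        (d : ℝ) ^ 4 * s ^ 2 * ‖p‖ ^ 2 * (matSup A + matSup C ^ 2 * (PhiA A)⁻¹ + ‖b‖ ^ 2) ≤
      (1 / 2) * (t ^ 2 * mdot A q q) + s * t * mdot (A + C) p q + s ^ 2 * t * ⟪b, p⟫ +
        (s * t) ^ 2 := by
  have hΦ := PhiA_pos hd hA
  have hΦq := PhiA_mul_sq_le hA q
  have hsymm : mdot A q p = mdot A p q := by rw [← mdot_transpose, hAs.eq]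
  have hpos := mdot_self_nonneg hA ((t / 2) • q + s • p)
  have hexp : mdot A ((t / 2) • q + s • p) ((t / 2) • q + s • p) =
      t ^ 2 / 4 * mdot A q q + s * t * mdot A p q + s ^ 2 * mdot A p p := by
    have hright (v : EuclideanSpace ℝ (Fin d)) : mdot A v ((t / 2) • q + s • p) =
        t / 2 * mdot A v q + s * mdot A v p := by
      rw [← mdot_transpose, mdot_add_left, mdot_smul_left, mdot_smul_left, mdot_transpose,
        mdot_transpose]
    rw [mdot_add_left, mdot_smul_left, mdot_smul_left, hright, hright, hsymm]
    ring
  have hd1 : (1 : ℝ) ≤ d := by exact_mod_cast Nat.one_le_iff_ne_zero.2 hd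
  have hd2 : (d : ℝ) ^ 2 ≤ (d : ℝ) ^ 4 := pow_le_pow_right₀ hd1 (by norm_num)
  have hd4 : (1 : ℝ) ≤ (d : ℝ) ^ 4 := one_le_pow₀ hd1
  have hApp : s ^ 2 * mdot A p p ≤ (d : ℝ) ^ 4 * (s ^ 2 * ‖p‖ ^ 2 * matSup A) := by
    have := le_of_abs_le (abs_mdot_le A p p)
    have hm := matSup_nonneg A
    calc s ^ 2 * mdot A p p ≤ s ^ 2 * ((d : ℝ) ^ 2 * (matSup A * ‖p‖ * ‖p‖)) := by gcongr
      _ = (d : ℝ) ^ 2 * (s ^ 2 * ‖p‖ ^ 2 * matSup A) := by ring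
      _ ≤ _ := by gcongr
  have hC : -(t ^ 2 / 4 * mdot A q q) -
      (d : ℝ) ^ 4 * (s ^ 2 * ‖p‖ ^ 2 * (matSup C ^ 2 * (PhiA A)⁻¹)) ≤ s * t * mdot C p q := by
    have h1 : |s * t * mdot C p q| ≤ |s * t| * ((d : ℝ) ^ 2 * (matSup C * ‖p‖ * ‖q‖)) := by
      rw [abs_mul]
      gcongr
      exact abs_mdot_le C p q
    have h2 : |s * t| * ((d : ℝ) ^ 2 * (matSup C * ‖p‖ * ‖q‖)) ≤
        t ^ 2 / 4 * (PhiA A * ‖q‖ ^ 2) +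
          (d : ℝ) ^ 4 * (s ^ 2 * ‖p‖ ^ 2 * (matSup C ^ 2 * (PhiA A)⁻¹)) := by
      have hsq := mul_nonneg (inv_pos.2 hΦ).le (sq_nonneg
        (|t| / 2 * (PhiA A * ‖q‖) - (d : ℝ) ^ 2 * (|s| * ‖p‖ * matSup C)))
      have hid : (PhiA A)⁻¹ *
          (|t| / 2 * (PhiA A * ‖q‖) - (d : ℝ) ^ 2 * (|s| * ‖p‖ * matSup C)) ^ 2 =
          |t| ^ 2 / 4 * (PhiA A * ‖q‖ ^ 2) +
            (d : ℝ) ^ 4 * (|s| ^ 2 * ‖p‖ ^ 2 * (matSup C ^ 2 * (PhiA A)⁻¹)) -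
            |s| * |t| * ((d : ℝ) ^ 2 * (matSup C * ‖p‖ * ‖q‖)) := by
        field_simp
        ring
      rw [hid, sq_abs, sq_abs] at hsq
      rw [abs_mul]
      linarith
    have h3 : t ^ 2 / 4 * (PhiA A * ‖q‖ ^ 2) ≤ t ^ 2 / 4 * mdot A q q := by gcongr
    linarith [neg_abs_le (s * t * mdot C p q)]
  have hB : -((1 / 2) * (s * t) ^ 2) - (d : ℝ) ^ 4 * (s ^ 2 * ‖p‖ ^ 2 * ‖b‖ ^ 2) ≤
      s ^ 2 * t * ⟪b, p⟫ := by
    have h1 : |⟪b, p⟫| ≤ ‖b‖ * ‖p‖ := abs_real_inner_le_norm b p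
    have h2 : ⟪b, p⟫ ^ 2 ≤ ‖p‖ ^ 2 * ‖b‖ ^ 2 := by
      calc ⟪b, p⟫ ^ 2 = |⟪b, p⟫| ^ 2 := (sq_abs _).symm
        _ ≤ (‖b‖ * ‖p‖) ^ 2 := by gcongr
        _ = _ := by ring
    have h3 : s ^ 2 * ⟪b, p⟫ ^ 2 ≤ s ^ 2 * (‖p‖ ^ 2 * ‖b‖ ^ 2) := by gcongr
    have h4 : 1 * (s ^ 2 * ‖p‖ ^ 2 * ‖b‖ ^ 2) ≤ (d : ℝ) ^ 4 * (s ^ 2 * ‖p‖ ^ 2 * ‖b‖ ^ 2) := by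
      gcongr
    nlinarith [mul_nonneg (sq_nonneg s) (sq_nonneg (t + ⟪b, p⟫)),
      mul_nonneg (sq_nonneg s) (sq_nonneg (⟪b, p⟫))]
  rw [mdot_add_matrix]
  linarith

end mdot

/-- A nonnegative monotone function of polynomial growth which gains a negative power of `r` when
compared with its value at `2 * r` vanishes for large `r`. -/
theorem Monotone.eq_zero_of_le_rpow_mul_comp_two_mul {f : ℝ → ℝ} (hmono : Monotone f)
    (hnonneg : ∀ r, 0 ≤ f r) {K δ β D R : ℝ} (hK : 0 ≤ K) (hδ : 0 < δ) (hD : 0 ≤ D) (hR : 0 < R)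
    (hstep : ∀ r, R ≤ r → f r ≤ K * r ^ (-δ) * f (2 * r))
    (hgrow : ∀ r, R ≤ r → f r ≤ D * r ^ β) {r : ℝ} (hr : R ≤ r) : f r = 0 := by
  have hiter (n : ℕ) : ∃ D' : ℝ, 0 ≤ D' ∧ ∀ r, R ≤ r → f r ≤ D' * r ^ (β - n * δ) := by
    induction n with
    | zero => exact ⟨D, hD, by simpa using hgrow⟩
    | succ n ih =>
      obtain ⟨D', hD', hle⟩ := ih
      refine ⟨K * (D' * 2 ^ (β - n * δ)), by positivity, fun r hr => ?_⟩
      have hr0 : 0 < r := hR.trans_le hr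
      calc f r ≤ K * r ^ (-δ) * f (2 * r) := hstep r hr
        _ ≤ K * r ^ (-δ) * (D' * (2 * r) ^ (β - n * δ)) := by
            gcongr
            exact hle _ (by linarith)
        _ = K * (D' * 2 ^ (β - n * δ)) * (r ^ (-δ) * r ^ (β - n * δ)) := by
            rw [Real.mul_rpow two_pos.le hr0.le]; ring
        _ = _ := by
            rw [← Real.rpow_add hr0]
            push_cast
            ring_nf
  obtain ⟨n, hn⟩ := exists_nat_gt (β / δ)
  rw [div_lt_iff₀ hδ] at hn
  obtain ⟨D', -, hle⟩ := hiter n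
  refine le_antisymm ?_ (hnonneg r)
  have hlim : Filter.Tendsto (fun s : ℝ => D' * s ^ (-(n * δ - β))) Filter.atTop (nhds 0) := by
    simpa using (tendsto_rpow_neg_atTop (sub_pos.2 hn)).const_mul D'
  refine _root_.ge_of_tendsto hlim ?_
  filter_upwards [Filter.eventually_ge_atTop r] with s hs
  rw [neg_sub]
  exact (hmono hs).trans (hle s (hr.trans hs))

theorem integrable_inner_of_hasCompactSupport {E : Type*} [NormedAddCommGroup E]
    [InnerProductSpace ℝ E] [FiniteDimensional ℝ E] [MeasurableSpace E] [BorelSpace E]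
    {μ : Measure E} {b g : E → E} (hb : Measurable b)
    (hbloc : LocallyIntegrable (fun x => ‖b x‖) μ) (hg : Continuous g)
    (hgs : HasCompactSupport g) : Integrable (fun x => ⟪b x, g x⟫) μ := by
  refine (hbloc.integrable_smul_left_of_hasCompactSupport hg.norm hgs.norm).mono'
    (hb.inner hg.measurable).aestronglyMeasurable (Filter.Eventually.of_forall fun x => ?_)
  rw [smul_eq_mul, mul_comm]
  exact norm_inner_le_norm (b x) (g x)

theorem HasCompactSupport.gradient {E : Type*} [NormedAddCommGroup E]
    [InnerProductSpace ℝ E] [CompleteSpace E] {f : E → ℝ} (hf : HasCompactSupport f) :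
    HasCompactSupport (gradient f) :=
  (hf.fderiv ℝ).comp_left (map_zero _)

theorem ContDiff.exists_lipschitzWith_of_hasCompactSupport {E : Type*} [NormedAddCommGroup E]
    [InnerProductSpace ℝ E] {f : E → ℝ} (hf : ContDiff ℝ 1 f)
    (hs : HasCompactSupport f) : ∃ K, LipschitzWith K f :=
  hf.lipschitzWith_of_hasCompactSupport hs one_ne_zero

/-- The energy identity obtained by testing the weak resolvent identity with `φ ^ 2 * h`. -/
theorem WeakResolvent.energy_identity {d : ℕ} {μ : Measure (EuclideanSpace ℝ (Fin d))}
    [IsLocallyFiniteMeasure μ] {A C : EuclideanSpace ℝ (Fin d) → Matrix (Fin d) (Fin d) ℝ}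
    (hAc : ∀ i j, Continuous fun x => A x i j) (hCc : ∀ i j, Continuous fun x => C x i j)
    (hCanti : ∀ x, (C x).transpose = -(C x))
    {Bb : EuclideanSpace ℝ (Fin d) → EuclideanSpace ℝ (Fin d)} (hBmeas : Measurable Bb)
    (hBloc : LocallyIntegrable (fun x => ‖Bb x‖) μ)
    (hBdiv : ∀ f : EuclideanSpace ℝ (Fin d) → ℝ, (∃ K, LipschitzWith K f) →
      HasCompactSupport f → ∫ x, ⟪Bb x, gradient f x⟫ ∂μ = 0)
    {h : EuclideanSpace ℝ (Fin d) → ℝ} (hh : ContDiff ℝ 1 h) (hres : WeakResolvent μ A C Bb h)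
    {φ : EuclideanSpace ℝ (Fin d) → ℝ} (hφ : ContDiff ℝ 1 φ) (hφs : HasCompactSupport φ) :
    Integrable (fun x => (1 / 2) * (φ x ^ 2 * mdot (A x) (gradient h x) (gradient h x)) +
        h x * φ x * mdot (A x + C x) (gradient φ x) (gradient h x) +
        h x ^ 2 * φ x * ⟪Bb x, gradient φ x⟫ + (h x * φ x) ^ 2) μ ∧
      ∫ x, ((1 / 2) * (φ x ^ 2 * mdot (A x) (gradient h x) (gradient h x)) +
        h x * φ x * mdot (A x + C x) (gradient φ x) (gradient h x) +
        h x ^ 2 * φ x * ⟪Bb x, gradient φ x⟫ + (h x * φ x) ^ 2) ∂μ = 0 := by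
  have hhd := hh.differentiable one_ne_zero
  have hφd := hφ.differentiable one_ne_zero
  have hw : ContDiff ℝ 1 fun x => φ x * h x := hφ.mul hh
  have hws : HasCompactSupport fun x => φ x * h x := hφs.mul_right
  have hwd := hw.differentiable one_ne_zero
  have hu : ContDiff ℝ 1 fun x => φ x * (φ x * h x) := hφ.mul hw
  have hus : HasCompactSupport fun x => φ x * (φ x * h x) := hφs.mul_right
  have hf : ContDiff ℝ 1 fun x => (φ x * h x) * (φ x * h x) := hw.mul hw
  have hfs : HasCompactSupport fun x => (φ x * h x) * (φ x * h x) := hws.mul_right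
  have hid := hres _ (hu.exists_lipschitzWith_of_hasCompactSupport hus) hus
  have hdiv := hBdiv _ (hf.exists_lipschitzWith_of_hasCompactSupport hfs) hfs
  have hI₁ : Integrable (fun x => mdot (A x + C x)
      (gradient (fun y => φ y * (φ y * h y)) x) (gradient h x)) μ := by
    refine (continuous_mdot (fun i j => ?_) hu.continuous_gradient_of_one
      hh.continuous_gradient_of_one).integrable_of_hasCompactSupport ?_
    · exact (hAc i j).add (hCc i j)
    · refine hus.gradient.mono fun x hx => ?_
      contrapose! hx
      simp [Function.notMem_support.1 hx, mdot]
  have hI₂ : Integrable (fun x => ⟪Bb x, gradient (fun y => φ y * (φ y * h y)) x⟫ * h x) μ := by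
    have := integrable_inner_of_hasCompactSupport hBmeas hBloc
      (hh.continuous.smul hu.continuous_gradient_of_one) (hus.gradient.smul_left (f := h))
    refine this.congr (Filter.Eventually.of_forall fun x => ?_)
    simp [real_inner_smul_right, mul_comm]
  have hI₃ : Integrable (fun x => φ x * (φ x * h x) * h x) μ :=
    (hu.continuous.mul hh.continuous).integrable_of_hasCompactSupport hus.mul_right
  have hI₄ : Integrable (fun x => ⟪Bb x, gradient (fun y => φ y * h y * (φ y * h y)) x⟫) μ :=
    integrable_inner_of_hasCompactSupport hBmeas hBloc hf.continuous_gradient_of_one hfs.gradient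
  have hpt : (fun x => (1 / 2) * (φ x ^ 2 * mdot (A x) (gradient h x) (gradient h x)) +
        h x * φ x * mdot (A x + C x) (gradient φ x) (gradient h x) +
        h x ^ 2 * φ x * ⟪Bb x, gradient φ x⟫ + (h x * φ x) ^ 2) = fun x =>
      (1 / 2) * mdot (A x + C x) (gradient (fun y => φ y * (φ y * h y)) x) (gradient h x) +
        ⟪Bb x, gradient (fun y => φ y * (φ y * h y)) x⟫ * h x + φ x * (φ x * h x) * h x -
        (1 / 2) * ⟪Bb x, gradient (fun y => φ y * h y * (φ y * h y)) x⟫ := by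
    ext x
    rw [gradient_mul_apply (hφd x) (hwd x), gradient_mul_apply (hwd x) (hwd x),
      gradient_mul_apply (hφd x) (hhd x)]
    simp only [smul_add, mdot_add_left, mdot_smul_left, mdot_add_matrix, inner_add_right,
      real_inner_smul_right, mdot_self_eq_zero (hCanti x)]
    ring
  rw [hpt]
  refine ⟨(((hI₁.const_mul _).add hI₂).add hI₃).sub (hI₄.const_mul _), ?_⟩
  rw [integral_sub, integral_add, integral_add, integral_const_mul, integral_const_mul, hid, hdiv]
  · simp
  exacts [hI₁.const_mul _, hI₂, (hI₁.const_mul _).add hI₂, hI₃,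
    ((hI₁.const_mul _).add hI₂).add hI₃, hI₄.const_mul _]

/-- Theorem 3.1(i): under polynomial volume growth of `μ` and the growth bound
`|A|_∞ + |C|_∞² Φ_A⁻¹ + ‖B̄‖² ≤ C₁‖x‖^{2α}` outside a ball, every bounded `C¹` function
satisfying the weak resolvent identity vanishes identically. -/
theorem stmt0 {d : ℕ} (hd : 2 ≤ d)
    (ρ : EuclideanSpace ℝ (Fin d) → ℝ) (hρc : Continuous ρ) (hρ : ∀ x, 0 < ρ x)
    (μ : Measure (EuclideanSpace ℝ (Fin d)))
    (hμ : μ = volume.withDensity fun x => ENNReal.ofReal (ρ x))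
    (A C : EuclideanSpace ℝ (Fin d) → Matrix (Fin d) (Fin d) ℝ)
    (hAc : ∀ i j, Continuous fun x => A x i j)
    (hAsymm : ∀ x, (A x).IsSymm) (hApos : ∀ x, (A x).PosDef)
    (hCc : ∀ i j, Continuous fun x => C x i j)
    (hCanti : ∀ x, (C x).transpose = -(C x))
    (Bb : EuclideanSpace ℝ (Fin d) → EuclideanSpace ℝ (Fin d))
    (hBmeas : Measurable Bb)
    (hBloc : LocallyIntegrable (fun x => ‖Bb x‖) μ)
    (hBdiv : ∀ f : EuclideanSpace ℝ (Fin d) → ℝ, (∃ K, LipschitzWith K f) →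
      HasCompactSupport f → ∫ x, ⟪Bb x, gradient f x⟫ ∂μ = 0)
    (c₁ c₂ : ℝ) (hc₁ : 0 < c₁) (hc₂ : 0 < c₂)
    (α : ℝ) (hα0 : 0 ≤ α) (hα1 : α < 1)
    (β : ℝ) (hβ : 0 ≤ β) (C₁ : ℝ) (hC₁ : 0 < C₁) (N₀ : ℕ)
    (hvol : ∀ r : ℝ, 0 < r → μ (Metric.ball 0 r) ≤ ENNReal.ofReal (c₁ * r ^ β + c₂))
    (hgrowth : ∀ᵐ x ∂(volume : Measure (EuclideanSpace ℝ (Fin d))),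
      (N₀ : ℝ) < ‖x‖ →
        matSup (A x) + matSup (C x) ^ 2 * (PhiA (A x))⁻¹ + ‖Bb x‖ ^ 2 ≤ C₁ * ‖x‖ ^ (2 * α))
    (h : EuclideanSpace ℝ (Fin d) → ℝ) (hh1 : ContDiff ℝ 1 h)
    (hhb : ∃ M, ∀ x, |h x| ≤ M)
    (hres : WeakResolvent μ A C Bb h) :
    ∀ x, h x = 0 := by
  obtain ⟨M, hM⟩ := hhb
  have hd0 : d ≠ 0 := by omega
  have hh := hh1.continuous
  have : IsLocallyFiniteMeasure μ := by
    refine ⟨fun x => ⟨Metric.ball 0 (‖x‖ + 1), Metric.isOpen_ball.mem_nhds (by simp), ?_⟩⟩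
    exact (hvol _ (by positivity)).trans_lt ENNReal.ofReal_lt_top
  have hac : μ ≪ volume := hμ ▸ withDensity_absolutelyContinuous _ _
  have : μ.IsOpenPosMeasure := by
    have hvac : (volume : Measure (EuclideanSpace ℝ (Fin d))) ≪ μ := by
      rw [hμ]
      exact withDensity_absolutelyContinuous' hρc.measurable.ennreal_ofReal.aemeasurable
        (Filter.Eventually.of_forall fun x => by simpa using hρ x)
    exact hvac.isOpenPosMeasure
  have hsqint (r : ℝ) : IntegrableOn (fun x => h x ^ 2) (Metric.closedBall 0 r) μ :=
    (hh.pow 2).continuousOn.integrableOn_compact (isCompact_closedBall _ _)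
  set I : ℝ → ℝ := fun r => ∫ x in Metric.closedBall 0 r, h x ^ 2 ∂μ with hIdef
  have hImono : Monotone I := fun r s hrs =>
    setIntegral_mono_set (hsqint s) (Filter.Eventually.of_forall fun x => sq_nonneg _)
      (Metric.closedBall_subset_closedBall hrs).eventuallyLE
  have hInonneg (r : ℝ) : 0 ≤ I r := integral_nonneg fun x => sq_nonneg _
  have hIgrow (r : ℝ) (hr : 1 ≤ r) : I r ≤ M ^ 2 * (c₁ * 2 ^ β + c₂) * r ^ β := by
    have hr0 : 0 < r := by linarith
    have hfin : μ (Metric.closedBall 0 r) < ⊤ := measure_closedBall_lt_top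
    have hμr : μ.real (Metric.closedBall 0 r) ≤ c₁ * (2 * r) ^ β + c₂ := by
      refine ENNReal.toReal_le_of_le_ofReal (by positivity) ?_
      exact (measure_mono (Metric.closedBall_subset_ball (by linarith))).trans
        (hvol (2 * r) (by positivity))
    have hone : 1 ≤ r ^ β := Real.one_le_rpow hr hβ
    calc I r ≤ ∫ x in Metric.closedBall 0 r, M ^ 2 ∂μ := by
          refine setIntegral_mono (hsqint r) (integrableOn_const hfin.ne) fun x => ?_
          exact sq_le_sq' (neg_le_of_abs_le (hM x)) (le_of_abs_le (hM x))
      _ = M ^ 2 * μ.real (Metric.closedBall 0 r) := by simp [mul_comm]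
      _ ≤ M ^ 2 * (c₁ * (2 * r) ^ β + c₂) := by gcongr
      _ ≤ M ^ 2 * ((c₁ * 2 ^ β + c₂) * r ^ β) := by
          rw [Real.mul_rpow two_pos.le hr0.le]
          gcongr
          nlinarith
      _ = _ := by ring
  obtain ⟨L, hL, hcut⟩ := exists_scaled_cutoff (EuclideanSpace ℝ (Fin d))
  have hIstep (r : ℝ) (hr : (N₀ : ℝ) + 1 ≤ r) :
      I r ≤ 2 * d ^ 4 * L ^ 2 * C₁ * 2 ^ (2 * α) * r ^ (-(2 - 2 * α)) * I (2 * r) := by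
    have hr0 : 0 < r := lt_of_lt_of_le (by positivity) hr
    obtain ⟨φ, hφ, hφs, hφ1, hφL, hφg⟩ := hcut r hr0
    obtain ⟨hFint, hF⟩ := hres.energy_identity hAc hCc hCanti hBmeas hBloc hBdiv hh1 hφ hφs
    set K : ℝ := d ^ 4 * L ^ 2 * C₁ * 2 ^ (2 * α) * r ^ (-(2 - 2 * α)) with hKdef
    have hK : 0 ≤ K := by positivity
    have hsqs : HasCompactSupport fun x => (h x * φ x) ^ 2 :=
      (hφs.mul_left (f := h)).comp_left (g := fun t : ℝ => t ^ 2) (by simp)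
    have hsqφ : Integrable (fun x => (h x * φ x) ^ 2) μ :=
      ((hh.mul hφ.continuous).pow 2).integrable_of_hasCompactSupport hsqs
    have hind : Integrable ((Metric.closedBall 0 (2 * r)).indicator fun x => h x ^ 2) μ :=
      (hsqint (2 * r)).integrable_indicator measurableSet_closedBall
    have hle : ∫ x, ((1 / 2) * (h x * φ x) ^ 2 -
        K * (Metric.closedBall 0 (2 * r)).indicator (fun x => h x ^ 2) x) ∂μ ≤ 0 := by
      rw [← hF]
      refine integral_mono_ae ((hsqφ.const_mul _).sub (hind.const_mul _)) hFint ?_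
      filter_upwards [hac.ae_le hgrowth] with x hx
      refine le_trans ?_ (energy_integrand_ge hd0 (hApos x) (hAsymm x) (Bb x) (gradient φ x)
        (gradient h x) (h x) (φ x))
      refine sub_le_sub_left ?_ _
      by_cases hg : gradient φ x = 0
      · simp only [hg, norm_zero]
        have : 0 ≤ (Metric.closedBall 0 (2 * r)).indicator (fun x => h x ^ 2) x :=
          Set.indicator_nonneg (fun _ _ => sq_nonneg _) _
        simpa using mul_nonneg hK this
      · obtain ⟨hrx, hxr⟩ := hφg x hg
        rw [Set.indicator_of_mem (by simpa using hxr)]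
        have hpow : ‖x‖ ^ (2 * α) ≤ 2 ^ (2 * α) * r ^ (2 * α) := by
          rw [← Real.mul_rpow two_pos.le hr0.le]
          exact Real.rpow_le_rpow (norm_nonneg _) hxr (by positivity)
        have hrr : r ^ (-(2 - 2 * α)) = (r ^ 2)⁻¹ * r ^ (2 * α) := by
          rw [← Real.rpow_natCast, ← Real.rpow_neg hr0.le, ← Real.rpow_add hr0]
          congr 1
          push_cast
          ring
        calc (d : ℝ) ^ 4 * h x ^ 2 * ‖gradient φ x‖ ^ 2 *
              (matSup (A x) + matSup (C x) ^ 2 * (PhiA (A x))⁻¹ + ‖Bb x‖ ^ 2)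
            ≤ (d : ℝ) ^ 4 * h x ^ 2 * ‖gradient φ x‖ ^ 2 * (C₁ * ‖x‖ ^ (2 * α)) := by
              gcongr
              exact hx (by linarith)
          _ ≤ (d : ℝ) ^ 4 * h x ^ 2 * (L / r) ^ 2 * (C₁ * (2 ^ (2 * α) * r ^ (2 * α))) := by
              gcongr
              exact hφL x
          _ = K * h x ^ 2 := by
              rw [hKdef, hrr]
              ring
    rw [integral_sub (hsqφ.const_mul _) (hind.const_mul _), integral_const_mul,
      integral_const_mul, integral_indicator measurableSet_closedBall] at hle
    have hlow : I r ≤ ∫ x, (h x * φ x) ^ 2 ∂μ := by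
      calc I r = ∫ x in Metric.closedBall 0 r, (h x * φ x) ^ 2 ∂μ := by
            refine setIntegral_congr_fun measurableSet_closedBall fun x hx => ?_
            simp [hφ1 x (by simpa using hx)]
        _ ≤ _ := setIntegral_le_integral hsqφ (Filter.Eventually.of_forall fun x => sq_nonneg _)
    have : I r ≤ 2 * (K * I (2 * r)) := by
      simp only [hIdef] at hlow ⊢
      linarith
    refine this.trans_eq ?_
    rw [hKdef]
    ring
  have hIzero (r : ℝ) (hr : (N₀ : ℝ) + 1 ≤ r) : I r = 0 :=
    hImono.eq_zero_of_le_rpow_mul_comp_two_mul hInonneg (by positivity) (by linarith)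
      (by positivity) (by positivity) hIstep
      (fun s hs => hIgrow s (by linarith [(Nat.cast_nonneg N₀ : (0 : ℝ) ≤ N₀)])) hr
  intro x
  by_contra hx
  have hr : (N₀ : ℝ) + 1 ≤ N₀ + 1 + ‖x‖ := by linarith [norm_nonneg x]
  have hpos : 0 < I (N₀ + 1 + ‖x‖) := by
    refine (setIntegral_pos_iff_support_of_nonneg_ae
      (Filter.Eventually.of_forall fun y => sq_nonneg (h y)) (hsqint _)).2 ?_
    refine lt_of_lt_of_le (IsOpen.measure_pos μ (U := {y | h y ≠ 0} ∩
      Metric.ball 0 (N₀ + 1 + ‖x‖)) ((isOpen_ne_fun hh continuous_const).inter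
      Metric.isOpen_ball) ⟨x, hx, ?_⟩) (measure_mono ?_)
    · rw [mem_ball_zero_iff]
      linarith [(Nat.cast_nonneg N₀ : (0 : ℝ) ≤ N₀)]
    · refine Set.inter_subset_inter (fun y hy => ?_) Metric.ball_subset_closedBall
      simpa using hy
  exact hpos.ne' (hIzero _ hr)
end
end

section
/- Let α ∈ [0,1), β ∈ [0,∞), C₂ > 0, c₁, c₂ ≥ 0 and N₀ ∈ ℕ with N₀ ≥ 1. Let φ : ℕ → ℝ be nonnegative and nondecreasing, and suppose that φ(n) ≤ C₂ · n^{α−1} · φ(2n) for every n ≥ N₀ and φ(n) ≤ c₁ n^β + c₂ for every n ≥ 1. Then φ(n) = 0 for every n ∈ ℕ. -/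
open Filter Topology

theorem isBigO_rpow_comp_two_mul {φ : ℕ → ℝ} {γ : ℝ}
    (h : φ =O[atTop] fun n : ℕ => (n : ℝ) ^ γ) :
    (fun n => φ (2 * n)) =O[atTop] fun n : ℕ => (n : ℝ) ^ γ := by
  have htwo : Tendsto (fun n : ℕ => 2 * n) atTop atTop :=
    tendsto_id.const_mul_atTop' two_pos
  refine (h.comp_tendsto htwo).trans ?_
  refine Asymptotics.IsBigO.of_bound ((2 : ℝ) ^ γ) (Eventually.of_forall fun n => ?_)
  have hmul : ((2 * n : ℕ) : ℝ) ^ γ = 2 ^ γ * (n : ℝ) ^ γ := by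
    push_cast
    exact Real.mul_rpow two_pos.le n.cast_nonneg
  simp only [Function.comp_apply, hmul, norm_mul]
  rw [Real.norm_of_nonneg (by positivity : (0 : ℝ) ≤ 2 ^ γ)]

/-- Each use of the doubling bound lowers the polynomial growth exponent by `1 - α`. -/
theorem isBigO_rpow_of_doubling_bound {φ : ℕ → ℝ} {α β C : ℝ} {N : ℕ} (hφ0 : ∀ n, 0 ≤ φ n)
    (hiter : ∀ n, N ≤ n → φ n ≤ C * (n : ℝ) ^ (α - 1) * φ (2 * n))
    (hφβ : φ =O[atTop] fun n : ℕ => (n : ℝ) ^ β) (k : ℕ) :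
    φ =O[atTop] fun n : ℕ => (n : ℝ) ^ (β - k * (1 - α)) := by
  induction k with
  | zero => simpa using hφβ
  | succ k ih =>
    have hstep : φ =O[atTop] fun n : ℕ => (n : ℝ) ^ (α - 1) * φ (2 * n) := by
      refine Asymptotics.IsBigO.of_bound C ?_
      filter_upwards [eventually_ge_atTop N] with n hn
      have hnonneg := hφ0 (2 * n)
      rw [Real.norm_of_nonneg (hφ0 n), Real.norm_of_nonneg (by positivity), ← mul_assoc]
      exact hiter n hn
    refine (hstep.trans ((Asymptotics.isBigO_refl _ _).mul (isBigO_rpow_comp_two_mul ih))).congr'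
      EventuallyEq.rfl ?_
    filter_upwards [eventually_gt_atTop 0] with n hn
    rw [← Real.rpow_add (by exact_mod_cast hn)]
    congr 1
    push_cast
    ring


/-- The iteration lemma underlying Theorem 3.1(i): a nonnegative nondecreasing function
`φ : ℕ → ℝ` satisfying `φ(n) ≤ C₂ n^{α-1} φ(2n)` for `n ≥ N₀` and the polynomial bound
`φ(n) ≤ c₁ n^β + c₂` for `n ≥ 1` vanishes identically. -/
theorem stmt3 (α β C₂ c₁ c₂ : ℝ) (hα0 : 0 ≤ α) (hα1 : α < 1) (hβ : 0 ≤ β)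
    (hC₂ : 0 < C₂) (hc₁ : 0 ≤ c₁) (hc₂ : 0 ≤ c₂) (N₀ : ℕ) (hN₀ : 1 ≤ N₀)
    (φ : ℕ → ℝ) (hφ0 : ∀ n, 0 ≤ φ n) (hmono : Monotone φ)
    (hiter : ∀ n, N₀ ≤ n → φ n ≤ C₂ * (n : ℝ) ^ (α - 1) * φ (2 * n))
    (hpoly : ∀ n : ℕ, 1 ≤ n → φ n ≤ c₁ * (n : ℝ) ^ β + c₂) :
    ∀ n, φ n = 0 := by
  have hφβ : φ =O[atTop] fun n : ℕ => (n : ℝ) ^ β := by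
    refine Asymptotics.IsBigO.of_bound (c₁ + c₂) ?_
    filter_upwards [eventually_ge_atTop 1] with n hn
    have hpow : 1 ≤ (n : ℝ) ^ β := Real.one_le_rpow (by exact_mod_cast hn) hβ
    rw [Real.norm_of_nonneg (hφ0 n), Real.norm_of_nonneg (by positivity)]
    nlinarith [hpoly n hn]
  obtain ⟨k, hk⟩ := exists_nat_gt (β / (1 - α))
  have hlim : Tendsto φ atTop (𝓝 0) := by
    refine (isBigO_rpow_of_doubling_bound hφ0 hiter hφβ k).trans_tendsto ?_
    have hexp : 0 < k * (1 - α) - β := by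
      rw [div_lt_iff₀ (by linarith)] at hk
      linarith
    simpa [Function.comp_def] using
      (tendsto_rpow_neg_atTop hexp).comp (tendsto_natCast_atTop_atTop (R := ℝ))
  exact fun n => le_antisymm (hmono.ge_of_tendsto hlim n) (hφ0 n)
end
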